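/- arXiv:2203.04485 — 4 statements merged into one kernel-verified Lean document; each statement's English description precedes it below -/
import Mathlib

section
/- Countable subadditivity of the inverse-capital outer measure: for any sequence of subsets A_n ⊆ Ω, n ∈ ℕ, one has μ*(⋃_{n ∈ ℕ} A_n) ≤ Σ_{n ∈ ℕ} μ*(A_n). -/
open MeasureTheory Filter ENNReal

/-- A stopping time with values in `ℕ∞ = ℕ ∪ {∞}` with respect to a filtration `F`:
`{ω | τ ω ≤ t}` is `F t`-measurable for every `t ∈ ℕ`. -/
def IsStopTime {Ω : Type*} {m : MeasurableSpace Ω} (F : Filtration ℕ m) (τ : Ω → ℕ∞) : Prop :=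
  ∀ t : ℕ, MeasurableSet[F t] {ω | τ ω ≤ (t : ℕ∞)}

/-- The inverse-capital outer measure associated with a family `Ps` of measures:
`μ*(A) = inf { sup_{P ∈ Ps} P(τ < ∞) : τ a stopping time with A ⊆ {τ < ∞} }`. -/
noncomputable def invCap {Ω : Type*} {m : MeasurableSpace Ω} (F : Filtration ℕ m)
    (Ps : Set (Measure Ω)) (A : Set Ω) : ℝ≥0∞ :=
  ⨅ (τ : Ω → ℕ∞) (_ : IsStopTime F τ ∧ A ⊆ {ω | τ ω ≠ ⊤}),
    ⨆ P ∈ Ps, P {ω | τ ω ≠ ⊤}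


theorem ENat.iInf_le_natCast_iff {ι : Sort*} {f : ι → ℕ∞} {t : ℕ} :
    ⨅ i, f i ≤ (t : ℕ∞) ↔ ∃ i, f i ≤ (t : ℕ∞) := by
  simp only [← ENat.lt_add_one_iff (ENat.natCast_ne_top t), iInf_lt_iff]

theorem IsStopTime.iInf {Ω ι : Type*} [Countable ι] {m : MeasurableSpace Ω} {F : Filtration ℕ m}
    {τ : ι → Ω → ℕ∞} (hτ : ∀ i, IsStopTime F (τ i)) :
    IsStopTime F fun ω ↦ ⨅ i, τ i ω := by
  intro t
  simp only [ENat.iInf_le_natCast_iff, Set.ofPred_exists]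
  exact MeasurableSet.iUnion fun i ↦ hτ i t

theorem setOf_iInf_ne_top {Ω ι : Type*} (τ : ι → Ω → ℕ∞) :
    {ω | ⨅ i, τ i ω ≠ ⊤} = ⋃ i, {ω | τ i ω ≠ ⊤} := by
  ext ω
  simp [iInf_eq_top]

theorem exists_isStopTime_of_invCap_lt {Ω : Type*} {m : MeasurableSpace Ω} {F : Filtration ℕ m}
    {Ps : Set (Measure Ω)} {A : Set Ω} {c : ℝ≥0∞} (h : invCap F Ps A < c) :
    ∃ τ : Ω → ℕ∞, IsStopTime F τ ∧ A ⊆ {ω | τ ω ≠ ⊤} ∧ ∀ P ∈ Ps, P {ω | τ ω ≠ ⊤} ≤ c := by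
  simp only [invCap, iInf_lt_iff] at h
  obtain ⟨τ, ⟨hτ, hA⟩, hc⟩ := h
  exact ⟨τ, hτ, hA, fun P hP ↦ (le_iSup₂ (f := fun P (_ : P ∈ Ps) ↦ P {ω | τ ω ≠ ⊤}) P hP).trans
    hc.le⟩

/-- Countable subadditivity of the inverse-capital outer measure. -/
theorem invCap_iUnion_le {Ω : Type*} {m : MeasurableSpace Ω} (F : Filtration ℕ m)
    (Ps : Set (Measure Ω)) (hprob : ∀ P ∈ Ps, IsProbabilityMeasure P)
    (A : ℕ → Set Ω) :
    invCap F Ps (⋃ n, A n) ≤ ∑' n, invCap F Ps (A n) := by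
  refine ENNReal.le_of_forall_pos_le_add fun ε hε hfin ↦ ?_
  obtain ⟨δ, hδ, hδε⟩ := ENNReal.exists_pos_sum_of_countable' (coe_pos.2 hε).ne' ℕ
  have hlt n : invCap F Ps (A n) < invCap F Ps (A n) + δ n :=
    ENNReal.lt_add_right (ENNReal.ne_top_of_tsum_ne_top hfin.ne n) (hδ n).ne'
  choose τ hτ hA hP using fun n ↦ exists_isStopTime_of_invCap_lt (hlt n)
  have hsub : ⋃ n, A n ⊆ {ω | ⨅ n, τ n ω ≠ ⊤} := by
    rw [setOf_iInf_ne_top]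
    exact Set.iUnion_mono hA
  refine (iInf₂_le (fun ω ↦ ⨅ n, τ n ω) ⟨.iInf hτ, hsub⟩).trans (iSup₂_le fun P hPs ↦ ?_)
  calc P {ω | ⨅ n, τ n ω ≠ ⊤}
    _ ≤ ∑' n, P {ω | τ n ω ≠ ⊤} := by
      rw [setOf_iInf_ne_top]
      exact measure_iUnion_le _
    _ ≤ ∑' n, (invCap F Ps (A n) + δ n) := ENNReal.tsum_le_tsum fun n ↦ hP n P hPs
    _ = ∑' n, invCap F Ps (A n) + ∑' n, δ n := ENNReal.tsum_add
    _ ≤ ∑' n, invCap F Ps (A n) + ε := by gcongr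
end

section
/- Singleton case of the inverse-capital outer measure: if 𝒫 = {P} consists of a single probability measure and ℱ = σ(⋃_{t ∈ ℕ} ℱ_t), then μ*(A) = P(A) for every A ∈ ℱ. -/
open MeasureTheory Filter ENNReal

theorem IsStopTime.measurableSet_ne_top {Ω : Type*} {m : MeasurableSpace Ω} {F : Filtration ℕ m}
    {τ : Ω → ℕ∞} (hτ : IsStopTime F τ) : MeasurableSet {ω | τ ω ≠ ⊤} := by
  have h : {ω | τ ω ≠ ⊤} = ⋃ t : ℕ, {ω | τ ω ≤ (t : ℕ∞)} := by
    ext ω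
    simp only [Set.mem_ofPred_eq, Set.mem_iUnion]
    exact ⟨fun h ↦ ⟨(τ ω).toNat, (ENat.natCast_toNat h).ge⟩,
      fun ⟨t, ht⟩ ↦ ne_top_of_le_ne_top (ENat.natCast_ne_top t) ht⟩
  rw [h]
  exact .iUnion fun t ↦ F.le t _ (hτ t)

theorem ENat.iInf_le_coe_iff {ι : Type*} {f : ι → ℕ∞} {n : ℕ} :
    ⨅ i, f i ≤ (n : ℕ∞) ↔ ∃ i, f i ≤ (n : ℕ∞) := by
  refine ⟨fun h ↦ ?_, fun ⟨i, hi⟩ ↦ (iInf_le f i).trans hi⟩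
  have h' : ⨅ i, f i < ((n + 1 : ℕ) : ℕ∞) := h.trans_lt (by exact_mod_cast Nat.lt_succ_self n)
  obtain ⟨i, hi⟩ := iInf_lt_iff.1 h'
  exact ⟨i, Order.le_of_lt_add_one (by exact_mod_cast hi)⟩

theorem IsStopTime.finset_sup {Ω ι : Type*} {m : MeasurableSpace Ω} {F : Filtration ℕ m}
    {τ : ι → Ω → ℕ∞} (hτ : ∀ i, IsStopTime F (τ i)) (s : Finset ι) :
    IsStopTime F fun ω ↦ s.sup fun i ↦ τ i ω := by
  intro t
  simp only [Finset.sup_le_iff, Set.ofPred_forall]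
  exact s.measurableSet_biInter fun i _ ↦ hτ i t

open Classical in
theorem isStopTime_ite {Ω : Type*} {m : MeasurableSpace Ω} {F : Filtration ℕ m} {t : ℕ} {A : Set Ω}
    (hA : MeasurableSet[F t] A) : IsStopTime F fun ω ↦ if ω ∈ A then (t : ℕ∞) else ⊤ := by
  intro s
  by_cases hts : t ≤ s
  · convert F.mono hts _ hA using 1
    ext ω
    by_cases hω : ω ∈ A <;> simp [hω, hts]
  · convert @MeasurableSet.empty _ (F s) using 1
    ext ω
    by_cases hω : ω ∈ A <;> simp [hω, hts]

/-- `A` is enclosed, up to arbitrarily small `P`-measure, between events decided by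
stopping times: `{τ = ∞} ⊆ A ⊆ {σ < ∞}`. -/
def IsStopTimeRegular {Ω : Type*} {m : MeasurableSpace Ω} (F : Filtration ℕ m) (P : Measure Ω)
    (A : Set Ω) : Prop :=
  ∀ ε : ℝ≥0∞, ε ≠ 0 → ∃ σ τ : Ω → ℕ∞, IsStopTime F σ ∧ IsStopTime F τ ∧
    A ⊆ {ω | σ ω ≠ ⊤} ∧ Aᶜ ⊆ {ω | τ ω ≠ ⊤} ∧ P ({ω | σ ω ≠ ⊤} ∩ {ω | τ ω ≠ ⊤}) ≤ ε

theorem isStopTimeRegular_of_measurableSet {Ω : Type*} {m : MeasurableSpace Ω} {F : Filtration ℕ m}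
    {P : Measure Ω} {t : ℕ} {A : Set Ω} (hA : MeasurableSet[F t] A) : IsStopTimeRegular F P A := by
  classical
  refine fun ε _ ↦ ⟨_, _, isStopTime_ite hA, isStopTime_ite hA.compl, ?_, ?_, ?_⟩
  · intro ω hω
    simp [hω]
  · intro ω hω
    have : ω ∉ A := hω
    simp [this]
  · refine le_of_eq_of_le ?_ zero_le
    convert measure_empty (μ := P)
    ext ω
    by_cases hω : ω ∈ A <;> simp [hω]

theorem IsStopTimeRegular.compl {Ω : Type*} {m : MeasurableSpace Ω} {F : Filtration ℕ m}
    {P : Measure Ω} {A : Set Ω} (hA : IsStopTimeRegular F P A) : IsStopTimeRegular F P Aᶜ := by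
  intro ε hε
  obtain ⟨σ, τ, hσ, hτ, h₁, h₂, h₃⟩ := hA ε hε
  exact ⟨τ, σ, hτ, hσ, h₂, by rwa [compl_compl], by rwa [Set.inter_comm]⟩

theorem IsStopTimeRegular.iUnion {Ω : Type*} {m : MeasurableSpace Ω} {F : Filtration ℕ m}
    {P : Measure Ω} [IsFiniteMeasure P] {A : ℕ → Set Ω} (hA : ∀ n, IsStopTimeRegular F P (A n)) :
    IsStopTimeRegular F P (⋃ n, A n) := by
  intro ε hε
  have hε2 : ε / 2 ≠ 0 := (ENNReal.half_pos hε).ne'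
  obtain ⟨δ, hδ, hδε⟩ := ENNReal.exists_pos_sum_of_countable' hε2 ℕ
  choose σ τ hσ hτ hAσ hAτ hP using fun n ↦ hA n (δ n) (hδ n).ne'
  let U : ℕ → Set Ω := fun n ↦ {ω | σ n ω ≠ ⊤}
  let V : ℕ → Set Ω := fun n ↦ {ω | τ n ω ≠ ⊤}
  have hU : ∀ n, MeasurableSet (U n) := fun n ↦ (hσ n).measurableSet_ne_top
  have hσU : {ω | ⨅ n, σ n ω ≠ ⊤} = ⋃ n, U n := by
    ext ω
    simp [U, iInf_eq_top]
  obtain ⟨N, hN⟩ : ∃ N, P (⋃ n, U n) < P (Set.accumulate U N) + ε / 2 := by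
    have h := (tendsto_measure_iUnion_accumulate (μ := P) (f := U)).add_const (ε / 2)
    exact (h.eventually_const_lt (ENNReal.lt_add_right (measure_ne_top P _) hε2)).exists
  have hτV : {ω | (Finset.range (N + 1)).sup (fun n ↦ τ n ω) ≠ ⊤} = ⋂ n ≤ N, V n := by
    ext ω
    simp [V, ← lt_top_iff_ne_top, Finset.sup_lt_iff]
  refine ⟨_, _, .iInf hσ, .finset_sup hτ (Finset.range (N + 1)), ?_, ?_, ?_⟩
  · rw [hσU]
    exact Set.iUnion_mono hAσ
  · rw [hτV, Set.compl_iUnion]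
    exact Set.subset_iInter₂ fun n _ ↦ (Set.iInter_subset _ n).trans (hAτ n)
  · have hsub : (⋃ n, U n) ∩ (⋂ n ≤ N, V n) ⊆
        (⋃ n, U n ∩ V n) ∪ ((⋃ n, U n) \ Set.accumulate U N) := by
      rintro ω ⟨hωU, hωV⟩
      by_cases hω : ω ∈ Set.accumulate U N
      · obtain ⟨n, hn, hωn⟩ := Set.mem_accumulate.1 hω
        exact .inl (Set.mem_iUnion.2 ⟨n, hωn, Set.mem_iInter₂.1 hωV n hn⟩)
      · exact .inr ⟨hωU, hω⟩
    have hacc : MeasurableSet (Set.accumulate U N) := .biUnion (Set.to_countable _) fun n _ ↦ hU n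
    rw [hσU, hτV]
    calc P ((⋃ n, U n) ∩ (⋂ n ≤ N, V n))
        ≤ P (⋃ n, U n ∩ V n) + P ((⋃ n, U n) \ Set.accumulate U N) :=
          (measure_mono hsub).trans (measure_union_le _ _)
      _ ≤ ε / 2 + ε / 2 := by
          refine add_le_add ?_ ?_
          · exact (measure_iUnion_le _).trans ((ENNReal.tsum_le_tsum hP).trans hδε.le)
          · exact (measure_sdiff_lt_of_lt_add hacc.nullMeasurableSet
              (Set.accumulate_subset_iUnion N) (measure_ne_top P _) hN).le
      _ = ε := ENNReal.add_halves ε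

theorem MeasurableSet.isStopTimeRegular {Ω : Type*} {m : MeasurableSpace Ω} {F : Filtration ℕ m}
    (hgen : m = ⨆ t : ℕ, (F t : MeasurableSpace Ω)) {P : Measure Ω} [IsFiniteMeasure P]
    {A : Set Ω} (hA : MeasurableSet A) : IsStopTimeRegular F P A := by
  rw [hgen, MeasurableSpace.measurableSpace_iSup_eq] at hA
  induction A, hA using MeasurableSpace.generateFrom_induction with
  | hC A hA _ => exact isStopTimeRegular_of_measurableSet hA.choose_spec
  | empty => exact isStopTimeRegular_of_measurableSet (t := 0) (@MeasurableSet.empty _ (F 0))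
  | compl A _ ih => exact ih.compl
  | iUnion A _ ih => exact .iUnion ih

/-- Singleton case: if `Ps = {P}` and `ℱ = σ(⋃_t ℱ_t)`, then `μ*(A) = P(A)` for all `A ∈ ℱ`. -/
theorem invCap_singleton {Ω : Type*} {m : MeasurableSpace Ω} (F : Filtration ℕ m)
    (hgen : m = ⨆ t : ℕ, (F t : MeasurableSpace Ω))
    (P : Measure Ω) [IsProbabilityMeasure P]
    (A : Set Ω) (hA : MeasurableSet A) :
    invCap F {P} A = P A := by
  refine le_antisymm (ENNReal.le_of_forall_pos_le_add fun ε hε _ ↦ ?_) ?_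
  · obtain ⟨σ, τ, hσ, -, hAσ, hAτ, hP⟩ :=
      hA.isStopTimeRegular hgen (P := P) ε (ENNReal.coe_pos.2 hε).ne'
    have hsub : {ω | σ ω ≠ ⊤} ⊆ A ∪ {ω | σ ω ≠ ⊤} ∩ {ω | τ ω ≠ ⊤} := fun ω hω ↦
      (em (ω ∈ A)).imp id fun h ↦ ⟨hω, hAτ h⟩
    calc invCap F {P} A ≤ ⨆ Q ∈ ({P} : Set (Measure Ω)), Q {ω | σ ω ≠ ⊤} :=
          iInf₂_le σ ⟨hσ, hAσ⟩
      _ = P {ω | σ ω ≠ ⊤} := iSup_singleton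
      _ ≤ P A + P ({ω | σ ω ≠ ⊤} ∩ {ω | τ ω ≠ ⊤}) :=
          (measure_mono hsub).trans (measure_union_le _ _)
      _ ≤ P A + ε := by gcongr
  · refine le_iInf₂ fun τ hτ ↦ ?_
    rw [iSup_singleton]
    exact measure_mono hτ.2
end

section
/- E-process characterization, positive-measure case (existence part): for an arbitrary subset A ⊆ Ω and every ε > 0, there exists a 𝒫-e-process (E_t)_{t ∈ ℕ} such that lim_{t→∞} E_t(ω) = 1/(μ*(A) + ε) for every ω ∈ A. -/
open MeasureTheory Filter ENNReal

/-- The value `E_τ` of a process at a stopping time `τ`, defined as `limsup_{t→∞} E_t`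
on the event `{τ = ∞}`. -/
noncomputable def stopVal {Ω : Type*} (E : ℕ → Ω → ℝ≥0∞) (τ : Ω → ℕ∞) (ω : Ω) : ℝ≥0∞ :=
  if h : τ ω = ⊤ then Filter.limsup (fun t => E t ω) Filter.atTop
  else E ((τ ω).untop h) ω

/-- A `Ps`-e-process: a `[0,∞)`-valued adapted process `E` such that `∫ E_τ dP ≤ 1` for every
`P ∈ Ps` and every stopping time `τ`. -/
def IsEProcess {Ω : Type*} {m : MeasurableSpace Ω} (F : Filtration ℕ m)
    (Ps : Set (Measure Ω)) (E : ℕ → Ω → ℝ≥0∞) : Prop :=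
  (∀ t ω, E t ω ≠ ⊤) ∧ (∀ t, Measurable[F t] (E t)) ∧
    ∀ P ∈ Ps, ∀ τ : Ω → ℕ∞, IsStopTime F τ → ∫⁻ ω, stopVal E τ ω ∂P ≤ 1

/-- The all-or-nothing process that jumps from `0` to the constant `c` at time `τ`. -/
noncomputable def jumpProcess {Ω : Type*} (c : ℝ≥0∞) (τ : Ω → ℕ∞) (t : ℕ) : Ω → ℝ≥0∞ :=
  {ω | τ ω ≤ (t : ℕ∞)}.indicator fun _ => c

lemma jumpProcess_le_indicator {Ω : Type*} (c : ℝ≥0∞) (τ : Ω → ℕ∞) (t : ℕ) (ω : Ω) :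
    jumpProcess c τ t ω ≤ {ω | τ ω ≠ ⊤}.indicator (fun _ => c) ω :=
  Set.indicator_le_indicator_of_subset
    (fun _ hω => ne_top_of_le_ne_top (ENat.natCast_ne_top t) hω) (fun _ => zero_le) ω

lemma stopVal_le_of_forall_le {Ω : Type*} {E : ℕ → Ω → ℝ≥0∞} {ω : Ω} {b : ℝ≥0∞}
    (h : ∀ t, E t ω ≤ b) (σ : Ω → ℕ∞) : stopVal E σ ω ≤ b := by
  unfold stopVal
  split_ifs
  · exact Filter.limsup_le_of_le (by isBoundedDefault) (Eventually.of_forall h)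
  · exact h _

lemma isEProcess_jumpProcess {Ω : Type*} {m : MeasurableSpace Ω} {F : Filtration ℕ m}
    {Ps : Set (Measure Ω)} {τ : Ω → ℕ∞} (hτ : IsStopTime F τ) {c : ℝ≥0∞} (hc : c ≠ ⊤)
    (hP : ∀ P ∈ Ps, c * P {ω | τ ω ≠ ⊤} ≤ 1) : IsEProcess F Ps (jumpProcess c τ) := by
  refine ⟨fun t ω => ?_, fun t => measurable_const.indicator (hτ t), fun P hPs σ _ => ?_⟩
  · exact ne_top_of_le_ne_top hc (Set.indicator_le_self' (fun _ _ => zero_le) ω)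
  · calc ∫⁻ ω, stopVal (jumpProcess c τ) σ ω ∂P
        ≤ ∫⁻ ω, {ω | τ ω ≠ ⊤}.indicator (fun _ => c) ω ∂P :=
          lintegral_mono fun ω =>
            stopVal_le_of_forall_le (fun t => jumpProcess_le_indicator c τ t ω) σ
      _ ≤ c * P {ω | τ ω ≠ ⊤} := lintegral_indicator_const_le _ _
      _ ≤ 1 := hP P hPs

lemma tendsto_jumpProcess {Ω : Type*} (c : ℝ≥0∞) {τ : Ω → ℕ∞} {ω : Ω} (hω : τ ω ≠ ⊤) :
    Tendsto (fun t => jumpProcess c τ t ω) atTop (nhds c) := by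
  obtain ⟨n, hn⟩ := ENat.ne_top_iff_exists.mp hω
  refine tendsto_const_nhds.congr' ?_
  filter_upwards [eventually_ge_atTop n] with t ht
  have hle : τ ω ≤ (t : ℕ∞) := by rw [← hn]; exact_mod_cast ht
  simp [jumpProcess, hle]

lemma invCap_le_one {Ω : Type*} {m : MeasurableSpace Ω} (F : Filtration ℕ m)
    {Ps : Set (Measure Ω)} (hprob : ∀ P ∈ Ps, IsProbabilityMeasure P) (A : Set Ω) :
    invCap F Ps A ≤ 1 := by
  refine iInf₂_le_of_le (fun _ : Ω => (0 : ℕ∞)) ⟨fun t => by simp, fun _ _ => by simp⟩ ?_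
  exact iSup₂_le fun P hP => haveI := hprob P hP; prob_le_one

/-- Positive-measure case, existence part: for every `ε > 0` there is a `Ps`-e-process
converging to `1/(μ*(A) + ε)` on `A`. -/
theorem eprocess_exists_positive_case {Ω : Type*} {m : MeasurableSpace Ω} (F : Filtration ℕ m)
    (hgen : m = ⨆ t : ℕ, (F t : MeasurableSpace Ω))
    (Ps : Set (Measure Ω)) (hprob : ∀ P ∈ Ps, IsProbabilityMeasure P) (A : Set Ω)
    (ε : ℝ) (hε : 0 < ε) :
    ∃ E : ℕ → Ω → ℝ≥0∞, IsEProcess F Ps E ∧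
      ∀ ω ∈ A, Filter.Tendsto (fun t => E t ω) Filter.atTop
        (nhds (1 / (invCap F Ps A + ENNReal.ofReal ε))) := by
  set c : ℝ≥0∞ := invCap F Ps A + ENNReal.ofReal ε
  have hcap : invCap F Ps A ≠ ⊤ := ne_top_of_le_ne_top one_ne_top (invCap_le_one F hprob A)
  have hε' : ENNReal.ofReal ε ≠ 0 := (ENNReal.ofReal_pos.mpr hε).ne'
  have hlt : invCap F Ps A < c := ENNReal.lt_add_right hcap hε'
  have hc : c ≠ 0 := (zero_le.trans_lt hlt).ne'
  obtain ⟨τ, ⟨hτ, hA⟩, hsup⟩ : ∃ (τ : Ω → ℕ∞) (_ : IsStopTime F τ ∧ A ⊆ {ω | τ ω ≠ ⊤}),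
      ⨆ P ∈ Ps, P {ω | τ ω ≠ ⊤} < c := by simpa only [invCap, iInf_lt_iff] using hlt
  refine ⟨jumpProcess (1 / c) τ, isEProcess_jumpProcess hτ (by simp [hc]) fun P hP => ?_,
    fun ω hω => tendsto_jumpProcess _ (hA hω)⟩
  calc 1 / c * P {ω | τ ω ≠ ⊤} ≤ 1 / c * c := by
        gcongr
        exact (le_iSup₂ (f := fun P (_ : P ∈ Ps) => P {ω | τ ω ≠ ⊤}) P hP).trans hsup.le
    _ ≤ 1 := by rw [one_div]; exact ENNReal.inv_mul_le_one c
end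

section
/- Mixtures of e-processes witness countable unions: let (A_n)_{n ∈ ℕ} be subsets of Ω, let (w_n)_{n ∈ ℕ} be strictly positive reals with Σ_{n ∈ ℕ} w_n = 1, and for each n let (E^n_t)_{t ∈ ℕ} be a 𝒫-e-process with lim_{t→∞} E^n_t(ω) = ∞ for every ω ∈ A_n. Then the [0,∞]-valued process E'_t = Σ_{n ∈ ℕ} w_n E^n_t is adapted, satisfies ∫ E'_τ dP ≤ 1 for every P ∈ 𝒫 and every stopping time τ (with E'_τ := limsup_{t→∞} E'_t on {τ = ∞}), and lim_{t→∞} E'_t(ω) = ∞ for every ω ∈ ⋃_{n ∈ ℕ} A_n. -/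
open MeasureTheory Filter ENNReal

open scoped Topology

/-- The value `E_τ` on the event `{τ < ∞}`, extended by zero. -/
noncomputable def stopValFin {Ω : Type*} (X : ℕ → Ω → ℝ≥0∞) (τ : Ω → ℕ∞) (ω : Ω) : ℝ≥0∞ :=
  if τ ω = ⊤ then 0 else X (τ ω).toNat ω

/-- The truncation of `stopVal X τ` that drops the event `{k < τ < ∞}` and caps the value on
`{τ = ∞}` at `k`. -/
noncomputable def stopValTrunc {Ω : Type*} (X : ℕ → Ω → ℝ≥0∞) (τ : Ω → ℕ∞) (k : ℕ) (ω : Ω) :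
    ℝ≥0∞ :=
  if τ ω = ⊤ then min (limsup (fun t => X t ω) atTop) k
  else if τ ω ≤ k then X (τ ω).toNat ω else 0

section Measurability

variable {Ω : Type*} {mΩ : MeasurableSpace Ω} {X : ℕ → Ω → ℝ≥0∞} {τ : Ω → ℕ∞}

theorem measurable_eval_toNat (hX : ∀ t, Measurable (X t)) (hτ : Measurable τ) :
    Measurable fun ω => X (τ ω).toNat ω := by
  have h : Measurable fun p : ℕ × Ω => X p.1 p.2 := measurable_from_prod_countable_right hX
  have hN : Measurable fun ω => (τ ω).toNat :=
    (measurable_of_countable (fun x : ℕ∞ => x.toNat)).comp hτ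
  exact h.comp (hN.prodMk measurable_id)

theorem measurable_stopValFin (hX : ∀ t, Measurable (X t)) (hτ : Measurable τ) :
    Measurable (stopValFin X τ) :=
  Measurable.ite (hτ (measurableSet_singleton ⊤)) measurable_const (measurable_eval_toNat hX hτ)

theorem measurable_stopValTrunc (hX : ∀ t, Measurable (X t)) (hτ : Measurable τ) (k : ℕ) :
    Measurable (stopValTrunc X τ k) :=
  Measurable.ite (hτ (measurableSet_singleton ⊤))
    ((Measurable.limsup hX).min measurable_const)
    (Measurable.ite (hτ (Set.to_countable (Set.Iic (k : ℕ∞))).measurableSet)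
      (measurable_eval_toNat hX hτ) measurable_const)

theorem measurable_tsum_const_mul {w : ℕ → ℝ≥0∞} (hX : ∀ n, Measurable (X n)) :
    Measurable fun ω => ∑' n, w n * X n ω :=
  Measurable.tsum fun n => (hX n).const_mul (w n)

end Measurability

section Pointwise

variable {Ω : Type*} {X : ℕ → Ω → ℝ≥0∞} {τ : Ω → ℕ∞}

theorem stopVal_of_ne_top {ω : Ω} (h : τ ω ≠ ⊤) : stopVal X τ ω = X (τ ω).toNat ω := by
  obtain ⟨n, hn⟩ := ENat.ne_top_iff_exists.1 h
  have key : ∀ (x : ℕ∞) (hx : x ≠ ⊤), x.untop hx = x.toNat := by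
    intro x hx
    obtain ⟨n, rfl⟩ := ENat.ne_top_iff_exists.1 hx
    rfl
  rw [stopVal, dif_neg h, key]

theorem stopValFin_le_stopVal (ω : Ω) : stopValFin X τ ω ≤ stopVal X τ ω := by
  by_cases h : τ ω = ⊤
  · simp [stopValFin, h]
  · rw [stopVal_of_ne_top h, stopValFin, if_neg h]

theorem monotone_stopValTrunc : Monotone (stopValTrunc X τ) := by
  intro k l hkl ω
  have hc : (k : ℝ≥0∞) ≤ l := by exact_mod_cast hkl
  have hc' : (k : ℕ∞) ≤ l := by exact_mod_cast hkl
  unfold stopValTrunc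
  split_ifs with h1 h2 h3 h3
  · exact min_le_min_left _ hc
  · exact le_rfl
  · exact absurd (h2.trans hc') h3
  · exact zero_le
  · exact le_rfl

theorem iSup_stopValTrunc (ω : Ω) : ⨆ k, stopValTrunc X τ k ω = stopVal X τ ω := by
  by_cases h : τ ω = ⊤
  · simp only [stopValTrunc, stopVal, h, if_true, dite_true]
    rw [← inf_iSup_eq, ENNReal.iSup_natCast, inf_top_eq]
  · rw [stopVal_of_ne_top h]
    refine le_antisymm (iSup_le fun k => ?_) ?_
    · simp only [stopValTrunc, h, if_false]
      split_ifs <;> simp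
    · refine le_iSup_of_le (τ ω).toNat ?_
      simp [stopValTrunc, h, ENat.natCast_toNat h]

end Pointwise

namespace IsStopTime

variable {Ω : Type*} {m : MeasurableSpace Ω} {F : Filtration ℕ m} {τ : Ω → ℕ∞}

theorem measurable_iSup (hτ : IsStopTime F τ) : Measurable[⨆ n, F n] τ := by
  have hle : ∀ t : ℕ, MeasurableSet[⨆ n, F n] {ω | τ ω ≤ (t : ℕ∞)} :=
    fun t => le_iSup (fun n => F n) t _ (hτ t)
  refine @measurable_to_countable' _ _ (_) _ (⨆ n, F n) _ fun x => ?_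
  induction x using ENat.recTopCoe with
  | top =>
    have h : τ ⁻¹' {⊤} = (⋃ t : ℕ, {ω | τ ω ≤ (t : ℕ∞)})ᶜ := by
      ext ω
      simp only [Set.mem_preimage, Set.mem_singleton_iff, Set.mem_compl_iff, Set.mem_iUnion,
        Set.mem_ofPred_eq, not_exists, not_le, ENat.eq_top_iff_forall_gt]
    rw [h]
    exact (MeasurableSet.iUnion hle).compl
  | coe n =>
    have h : τ ⁻¹' {(n : ℕ∞)} =
        {ω | τ ω ≤ (n : ℕ∞)} \ ⋃ j ∈ Finset.range n, {ω | τ ω ≤ (j : ℕ∞)} := by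
      ext ω
      simp only [Set.mem_preimage, Set.mem_singleton_iff, Set.mem_sdiff, Set.mem_ofPred_eq,
        Set.mem_iUnion, Finset.mem_range, not_exists]
      induction τ ω using ENat.recTopCoe with
      | top => simp
      | coe i =>
        norm_cast
        refine ⟨fun h => ⟨h.le, fun j hj => by omega⟩, fun h => ?_⟩
        by_contra hne
        exact h.2 i (by omega) le_rfl
    rw [h]
    exact (hle n).diff (Finset.measurableSet_biUnion _ fun j _ => hle j)

theorem measurable (hτ : IsStopTime F τ) : Measurable τ :=
  hτ.measurable_iSup.mono (iSup_le F.le) le_rfl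

theorem min {σ : Ω → ℕ∞} (hτ : IsStopTime F τ) (hσ : IsStopTime F σ) :
    IsStopTime F fun ω => min (τ ω) (σ ω) := by
  intro t
  have h : {ω | Min.min (τ ω) (σ ω) ≤ (t : ℕ∞)} =
      {ω | τ ω ≤ (t : ℕ∞)} ∪ {ω | σ ω ≤ (t : ℕ∞)} := by
    ext ω
    simp
  rw [h]
  exact (hτ t).union (hσ t)

end IsStopTime

open Classical in
/-- The first time `t` with `ω ∈ B t`. -/
noncomputable def firstEntry {Ω : Type*} (B : ℕ → Set Ω) (ω : Ω) : ℕ∞ :=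
  if h : ∃ t, ω ∈ B t then (Nat.find h : ℕ∞) else ⊤

theorem firstEntry_le_iff {Ω : Type*} {B : ℕ → Set Ω} {ω : Ω} {t : ℕ} :
    firstEntry B ω ≤ t ↔ ∃ j ≤ t, ω ∈ B j := by
  classical
  unfold firstEntry
  split_ifs with h
  · rw [Nat.cast_le, Nat.find_le_iff]
  · simp only [top_le_iff, ENat.natCast_ne_top, false_iff]
    exact fun ⟨j, _, hj⟩ => h ⟨j, hj⟩

theorem exists_firstEntry_eq {Ω : Type*} {B : ℕ → Set Ω} {ω : Ω} (h : ∃ t, ω ∈ B t) :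
    ∃ t : ℕ, firstEntry B ω = t ∧ ω ∈ B t := by
  classical
  exact ⟨Nat.find h, by rw [firstEntry, dif_pos h], Nat.find_spec h⟩

theorem isStopTime_firstEntry {Ω : Type*} {m : MeasurableSpace Ω} {F : Filtration ℕ m}
    {B : ℕ → Set Ω} (hB : ∀ t, MeasurableSet[F t] (B t)) : IsStopTime F (firstEntry B) := by
  intro t
  have h : {ω | firstEntry B ω ≤ (t : ℕ∞)} = ⋃ j ∈ Finset.range (t + 1), B j := by
    ext ω
    simp [firstEntry_le_iff]
  rw [h]
  exact Finset.measurableSet_biUnion _ fun j hj =>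
    F.mono (Nat.lt_succ_iff.1 (Finset.mem_range.1 hj)) _ (hB j)

/-- If `z` is below `limsup x + δ`, then `x` comes within `δ` of `z` at arbitrarily late times. -/
theorem exists_ge_lt_add_of_lt_limsup_add {x : ℕ → ℝ≥0∞} {z δ : ℝ≥0∞} (hδ : δ ≠ ∞)
    (h : z < limsup x atTop + δ) (s : ℕ) : ∃ t ≥ s, z < x t + δ := by
  by_contra! hcon
  have hle : limsup x atTop ≤ z - δ := by
    refine limsup_le_of_le (by isBoundedDefault) ?_
    filter_upwards [eventually_ge_atTop s] with t ht
    exact ENNReal.le_sub_of_add_le_right hδ (hcon t ht)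
  have hz : δ ≤ z := le_add_self.trans (hcon s le_rfl)
  refine lt_irrefl z (h.trans_le ?_)
  simpa only [tsub_add_cancel_of_le hz] using add_le_add_left hle δ

/-- Capping at level `k` and approximating the capped value by an `F s`-measurable `Z`, one
dominates the truncated stopped value by the value at a stopping time, restricted to the event
that it is finite. -/
theorem exists_isStopTime_stopValTrunc_le {Ω : Type*} {m : MeasurableSpace Ω} {F : Filtration ℕ m}
    {X : ℕ → Ω → ℝ≥0∞} (hX : ∀ t, Measurable[F t] (X t)) {τ : Ω → ℕ∞} (hτ : IsStopTime F τ)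
    {k s : ℕ} (hks : k ≤ s) {Z : Ω → ℝ≥0∞} (hZ : Measurable[F s] Z) {D : Ω → ℝ≥0∞}
    (hWZ : ∀ ω, τ ω = ⊤ → stopValTrunc X τ k ω ≤ Z ω + D ω)
    (hZW : ∀ ω, τ ω = ⊤ → Z ω ≤ stopValTrunc X τ k ω + D ω)
    {δ : ℝ≥0∞} (hδ0 : δ ≠ 0) (hδ : δ ≠ ∞) :
    ∃ σ, IsStopTime F σ ∧
      ∀ ω, stopValTrunc X τ k ω ≤ stopValFin X σ ω + δ + (1 + k / δ) * D ω := by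
  let B : ℕ → Set Ω := fun t => {ω | s ≤ t ∧ Z ω < X t ω + δ}
  have hB : ∀ t, MeasurableSet[F t] (B t) := by
    intro t
    by_cases hst : s ≤ t
    · simp only [B, hst, true_and]
      exact measurableSet_lt (hZ.mono (F.mono hst) le_rfl)
        ((hX t).add_const δ)
    · simp [B, hst]
  refine ⟨_, hτ.min (isStopTime_firstEntry hB), fun ω => ?_⟩
  by_cases hω : τ ω = ⊤
  · rcases le_or_gt δ (D ω) with hD | hD
    · calc stopValTrunc X τ k ω ≤ k := by simp [stopValTrunc, hω]
        _ = k / δ * δ := (ENNReal.div_mul_cancel hδ0 hδ).symm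
        _ ≤ (1 + k / δ) * D ω := mul_le_mul' le_add_self hD
        _ ≤ _ := le_add_self
    · have hlt : Z ω < limsup (fun t => X t ω) atTop + δ := by
        have hfin : stopValTrunc X τ k ω ≠ ∞ := by simp [stopValTrunc, hω]
        calc Z ω ≤ stopValTrunc X τ k ω + D ω := hZW ω hω
          _ < stopValTrunc X τ k ω + δ := (ENNReal.add_lt_add_iff_left hfin).2 hD
          _ ≤ _ := by gcongr; simp [stopValTrunc, hω]
      obtain ⟨t₀, hst₀, ht₀⟩ := exists_ge_lt_add_of_lt_limsup_add hδ hlt s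
      obtain ⟨t, ht, hBt⟩ := exists_firstEntry_eq (B := B) ⟨t₀, hst₀, ht₀⟩
      have hfin : stopValFin X (fun ω => min (τ ω) (firstEntry B ω)) ω = X t ω := by
        simp [stopValFin, hω, ht]
      rw [hfin]
      calc stopValTrunc X τ k ω ≤ Z ω + D ω := hWZ ω hω
        _ ≤ (X t ω + δ) + (1 + k / δ) * D ω :=
          add_le_add hBt.2.le (le_mul_of_one_le_left' le_self_add)
  · by_cases hk : τ ω ≤ k
    · have hge : τ ω ≤ firstEntry B ω := by
        by_cases h : ∃ t, ω ∈ B t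
        · obtain ⟨t, ht, hBt⟩ := exists_firstEntry_eq h
          rw [ht]
          exact hk.trans (by exact_mod_cast hks.trans hBt.1)
        · simp [firstEntry, h]
      have heq : stopValFin X (fun ω => min (τ ω) (firstEntry B ω)) ω = X (τ ω).toNat ω := by
        simp [stopValFin, min_eq_left hge, hω]
      rw [heq, add_assoc]
      simp [stopValTrunc, hω, hk]
    · simp [stopValTrunc, hω, hk]

/-- A bound on `∫ X_σ 1_{σ < ∞} dP` that is uniform in the stopping time `σ` also bounds
`∫ X_τ dP`, where `X_τ` is the limit superior of `X` on `{τ = ∞}`. -/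
theorem lintegral_stopVal_le_of_lintegral_stopValFin_le {Ω : Type*} {m : MeasurableSpace Ω}
    {F : Filtration ℕ m} {P : Measure Ω} [IsProbabilityMeasure P] {X : ℕ → Ω → ℝ≥0∞}
    (hX : ∀ t, Measurable[F t] (X t)) {C : ℝ≥0∞}
    (hC : ∀ σ, IsStopTime F σ → ∫⁻ ω, stopValFin X σ ω ∂P ≤ C)
    {τ : Ω → ℕ∞} (hτ : IsStopTime F τ) : ∫⁻ ω, stopVal X τ ω ∂P ≤ C := by
  have hXm : ∀ t, Measurable (X t) := fun t => (hX t).mono (F.le t) le_rfl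
  have hXs : ∀ t, Measurable[⨆ n, F n] (X t) :=
    fun t => (hX t).mono (le_iSup (fun n => F n) t) le_rfl
  simp_rw [← iSup_stopValTrunc]
  rw [lintegral_iSup (measurable_stopValTrunc hXm hτ.measurable) monotone_stopValTrunc]
  refine iSup_le fun k => ENNReal.le_of_forall_pos_le_add fun ε hε _ => ?_
  have hε0 : (ε : ℝ≥0∞) ≠ 0 := by exact_mod_cast hε.ne'
  let V : Ω → ℝ≥0∞ := fun ω => if τ ω = ⊤ then stopValTrunc X τ k ω else 0
  have hVk : ∀ ω, V ω ≤ k := by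
    intro ω
    by_cases h : τ ω = ⊤ <;> simp [V, stopValTrunc, h]
  have hVtop : ∀ ω, V ω ≠ ∞ := fun ω => ne_top_of_le_ne_top (natCast_ne_top k) (hVk ω)
  have hV : Measurable[⨆ n, F n] V :=
    Measurable.ite (hτ.measurable_iSup (measurableSet_singleton ⊤))
      (measurable_stopValTrunc hXs hτ.measurable_iSup k) measurable_const
  let W : Ω → ℝ := fun ω => (V ω).toReal
  have hWs : StronglyMeasurable[⨆ n, F n] W := hV.ennreal_toReal.stronglyMeasurable
  have hWm : StronglyMeasurable W := hWs.mono (iSup_le F.le)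
  have hWint : Integrable W P := by
    refine Integrable.of_bound hWm.aestronglyMeasurable (k : ℝ) (ae_of_all _ fun ω => ?_)
    rw [Real.norm_of_nonneg ENNReal.toReal_nonneg]
    exact ENNReal.toReal_le_of_le_ofReal (Nat.cast_nonneg k) (by simpa using hVk ω)
  let D : ℕ → Ω → ℝ≥0∞ := fun s ω => ‖(P[W | F s] - W) ω‖ₑ
  have hD : Tendsto (fun s => ∫⁻ ω, D s ω ∂P) atTop (𝓝 0) := by
    simpa only [eLpNorm_one_eq_lintegral_enorm] using hWint.tendsto_eLpNorm_condExp hWs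
  have hstep : ∀ s ≥ k, ∫⁻ ω, stopValTrunc X τ k ω ∂P ≤
      C + ε + (1 + k / ε) * ∫⁻ ω, D s ω ∂P := by
    intro s hs
    have hZ : Measurable[F s] fun ω => ENNReal.ofReal ((P[W | F s]) ω) :=
      stronglyMeasurable_condExp.measurable.ennreal_ofReal
    have hVW : ∀ ω, τ ω = ⊤ → stopValTrunc X τ k ω = ENNReal.ofReal (W ω) := by
      intro ω hω
      rw [ENNReal.ofReal_toReal (hVtop ω)]
      simp [V, hω]
    have hdist : ∀ a b : ℝ, ENNReal.ofReal a ≤ ENNReal.ofReal b + ‖a - b‖ₑ := by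
      intro a b
      rw [← ofReal_norm]
      refine le_trans (ENNReal.ofReal_le_ofReal ?_) ENNReal.ofReal_add_le
      rw [Real.norm_eq_abs]
      linarith [le_abs_self (a - b)]
    obtain ⟨σ, hσ, hle⟩ := exists_isStopTime_stopValTrunc_le hX hτ hs hZ (D := D s)
      (fun ω hω => by
        rw [hVW ω hω]
        simpa only [D, Pi.sub_apply, enorm_sub_rev] using hdist (W ω) ((P[W | F s]) ω))
      (fun ω hω => by
        rw [hVW ω hω]
        exact hdist _ _)
      hε0 coe_ne_top
    have hDm : Measurable (D s) :=
      ((stronglyMeasurable_condExp.mono (F.le s)).sub hWm).measurable.enorm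
    calc ∫⁻ ω, stopValTrunc X τ k ω ∂P
        ≤ ∫⁻ ω, (stopValFin X σ ω + ε + (1 + k / ε) * D s ω) ∂P := lintegral_mono hle
      _ = ∫⁻ ω, stopValFin X σ ω ∂P + ε + (1 + k / ε) * ∫⁻ ω, D s ω ∂P := by
        rw [lintegral_add_right _ (hDm.const_mul _), lintegral_add_right _ measurable_const,
          lintegral_const_mul _ hDm]
        simp
      _ ≤ _ := by gcongr; exact hC σ hσ
  have hcoef : (1 + (k : ℝ≥0∞) / ε) ≠ ∞ :=
    add_ne_top.2 ⟨one_ne_top, div_ne_top (natCast_ne_top k) hε0⟩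
  have hlim : Tendsto (fun s => C + ε + (1 + k / ε) * ∫⁻ ω, D s ω ∂P) atTop (𝓝 (C + ε)) := by
    simpa using (ENNReal.Tendsto.const_mul hD (Or.inr hcoef)).const_add (C + (ε : ℝ≥0∞))
  exact ge_of_tendsto hlim ((eventually_ge_atTop k).mono hstep)

theorem stopValFin_tsum {Ω : Type*} (w : ℕ → ℝ≥0∞) (E : ℕ → ℕ → Ω → ℝ≥0∞) (σ : Ω → ℕ∞) (ω : Ω) :
    stopValFin (fun t ω => ∑' n, w n * E n t ω) σ ω = ∑' n, w n * stopValFin (E n) σ ω := by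
  unfold stopValFin
  split_ifs <;> simp

/-- Mixtures of e-processes witness countable unions: if each `Ps`-e-process `E n` tends to `∞`
on `A n`, and `w` are strictly positive weights summing to one, then the mixture
`E'_t = Σ_n w_n E^n_t` is adapted, satisfies `∫ E'_τ dP ≤ 1` for all `P ∈ Ps` and all
stopping times `τ`, and tends to `∞` on `⋃_n A n`. -/
theorem eprocess_mixture {Ω : Type*} {m : MeasurableSpace Ω} (F : Filtration ℕ m)
    (Ps : Set (Measure Ω)) (hprob : ∀ P ∈ Ps, IsProbabilityMeasure P)
    (A : ℕ → Set Ω) (w : ℕ → ℝ≥0∞) (hw : ∀ n, 0 < w n) (hw1 : ∑' n, w n = 1)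
    (E : ℕ → ℕ → Ω → ℝ≥0∞) (hE : ∀ n, IsEProcess F Ps (E n))
    (hlim : ∀ n, ∀ ω ∈ A n, Filter.Tendsto (fun t => E n t ω) Filter.atTop (nhds ⊤)) :
    (∀ t : ℕ, Measurable[F t] (fun ω => ∑' n, w n * E n t ω)) ∧
    (∀ P ∈ Ps, ∀ τ : Ω → ℕ∞, IsStopTime F τ →
      ∫⁻ ω, stopVal (fun t ω => ∑' n, w n * E n t ω) τ ω ∂P ≤ 1) ∧
    (∀ ω ∈ ⋃ n, A n,
      Filter.Tendsto (fun t => ∑' n, w n * E n t ω) Filter.atTop (nhds ⊤)) := by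
  have hmeas : ∀ t : ℕ, Measurable[F t] (fun ω => ∑' n, w n * E n t ω) :=
    fun t => measurable_tsum_const_mul fun n => (hE n).2.1 t
  refine ⟨hmeas, fun P hP τ hτ => ?_, fun ω hω => ?_⟩
  · have := hprob P hP
    refine lintegral_stopVal_le_of_lintegral_stopValFin_le hmeas (fun σ hσ => ?_) hτ
    have hm : ∀ n, Measurable (stopValFin (E n) σ) := fun n =>
      measurable_stopValFin (fun t => ((hE n).2.1 t).mono (F.le t) le_rfl) hσ.measurable
    simp_rw [stopValFin_tsum]
    rw [lintegral_tsum fun n => ((hm n).const_mul _).aemeasurable, ← hw1]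
    refine ENNReal.tsum_le_tsum fun n => ?_
    rw [lintegral_const_mul _ (hm n)]
    exact mul_le_of_le_one_right' ((lintegral_mono stopValFin_le_stopVal).trans
      ((hE n).2.2 P hP σ hσ))
  · obtain ⟨n, hn⟩ := Set.mem_iUnion.1 hω
    have h := ENNReal.Tendsto.const_mul (a := w n) (hlim n ω hn) (Or.inl top_ne_zero)
    rw [ENNReal.mul_top (hw n).ne'] at h
    exact tendsto_of_tendsto_of_tendsto_of_le_of_le h tendsto_const_nhds
      (fun t => ENNReal.le_tsum n) (fun t => le_top)
end
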